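/- Let c be a real number that is not zero or a negative integer. Then for every real z with |z| < 1, ∑_{n=0}^{∞} [((c+1)/2)_n · ((c−2)/2)_n / ((c)_n · n!)] · z^n = (2^{c−1}/c) · (1 + √(1 − z))^{1−c} · (c − 1 + √(1 − z)), where (a)_n = a(a+1)⋯(a+n−1) denotes the rising factorial (Pochhammer symbol) with (a)_0 = 1. -/

import Mathlib

open Real Polynomial

open Metric in
/-- Differentiating the hypergeometric equation `n` times gives the hypergeometric equation with
parameters shifted by `n`. -/
theorem hypergeometric_ode_iterate_deriv {a b c : ℂ} {f : ℂ → ℂ}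
    (hf : DifferentiableOn ℂ f (ball 0 1))
    (hode : ∀ z ∈ ball (0 : ℂ) 1,
      z * (1 - z) * deriv (deriv f) z + (c - (a + b + 1) * z) * deriv f z - a * b * f z = 0)
    (n : ℕ) : ∀ z ∈ ball (0 : ℂ) 1,
      z * (1 - z) * iteratedDeriv (n + 2) f z
        + (c + n - (a + b + 2 * n + 1) * z) * iteratedDeriv (n + 1) f z
        - (a + n) * (b + n) * iteratedDeriv n f z = 0 := by
  have hd : ∀ (m : ℕ), ∀ z ∈ ball (0 : ℂ) 1,
      HasDerivAt (iteratedDeriv m f) (iteratedDeriv (m + 1) f z) z := by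
    intro m z hz
    have h := ((hf.analyticOnNhd isOpen_ball).iterated_deriv m z hz).differentiableAt.hasDerivAt
    rw [← iteratedDeriv_eq_iterate] at h
    rwa [iteratedDeriv_succ]
  induction n with
  | zero =>
    intro z hz
    simpa [iteratedDeriv_succ, iteratedDeriv_zero] using hode z hz
  | succ n ih =>
    intro z hz
    have hid := hasDerivAt_id z
    have h := ((((hid.mul (hid.const_sub 1)).mul (hd (n + 2) z hz)).add
      (((hid.const_mul (a + b + 2 * n + 1)).const_sub (c + n)).mul (hd (n + 1) z hz))).sub
      ((hd n z hz).const_mul ((a + n) * (b + n))))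
    have h0 := h.unique ((hasDerivAt_const z (0 : ℂ)).congr_of_eventuallyEq
      (Filter.eventually_of_mem (isOpen_ball.mem_nhds hz) fun w hw => by simpa using ih w hw))
    simp only [id, Pi.mul_apply] at h0
    push_cast
    linear_combination h0

open Metric in
/-- A holomorphic solution of the hypergeometric equation on the unit disc is the sum of the
hypergeometric series, up to its value at `0`. -/
theorem hasSum_hypergeometric_of_ode {a b c : ℝ} (hc : ∀ n : ℕ, c ≠ -(n : ℝ)) {f : ℂ → ℂ}
    (hf : DifferentiableOn ℂ f (ball 0 1))
    (hode : ∀ z ∈ ball (0 : ℂ) 1,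
      z * (1 - z) * deriv (deriv f) z + (c - (a + b + 1) * z) * deriv f z - a * b * f z = 0)
    {z : ℂ} (hz : z ∈ ball (0 : ℂ) 1) :
    HasSum (fun n : ℕ => (((ascPochhammer ℝ n).eval a * (ascPochhammer ℝ n).eval b /
      ((ascPochhammer ℝ n).eval c * (Nat.factorial n : ℝ)) : ℝ) : ℂ) * z ^ n * f 0) (f z) := by
  have hcoef : ∀ n : ℕ, iteratedDeriv n f 0 = (((ascPochhammer ℝ n).eval a *
      (ascPochhammer ℝ n).eval b / (ascPochhammer ℝ n).eval c : ℝ) : ℂ) * f 0 := by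
    intro n
    induction n with
    | zero => simp
    | succ n ih =>
      have h := hypergeometric_ode_iterate_deriv hf hode n 0 (by simp)
      have hcn : (c : ℂ) + n ≠ 0 := by
        have := hc n
        norm_cast
        intro h
        exact this (by linarith)
      have h' : iteratedDeriv (n + 1) f 0
          = (a + n) * (b + n) / (c + n) * iteratedDeriv n f 0 := by
        field_simp
        linear_combination h
      rw [h', ih]
      simp only [ascPochhammer_succ_eval]
      push_cast
      simp only [div_eq_mul_inv, mul_inv]
      ring
  refine (Complex.hasSum_taylorSeries_on_ball hf hz).congr_fun ?_
  intro n
  rw [hcoef]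
  simp only [sub_zero, smul_eq_mul]
  push_cast
  simp only [div_eq_mul_inv, mul_inv]
  ring

open Metric in
theorem one_sub_mem_slitPlane {w : ℂ} (hw : w ∈ ball (0 : ℂ) 1) : 1 - w ∈ Complex.slitPlane := by
  left
  have h := Complex.re_le_norm w
  rw [mem_ball_zero_iff] at hw
  simp only [Complex.sub_re, Complex.one_re]
  linarith

theorem cpow_half_re_pos {u : ℂ} (hu : u ∈ Complex.slitPlane) : 0 < (u ^ (1 / 2 : ℂ)).re := by
  have h0 := Complex.slitPlane_ne_zero hu
  have h1 := Complex.neg_pi_lt_arg u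
  have h2 := lt_of_le_of_ne (Complex.arg_le_pi u) (Complex.mem_slitPlane_iff_arg.1 hu).1
  rw [Complex.cpow_def_of_ne_zero h0, Complex.exp_re]
  have him : (Complex.log u * (1 / 2)).im = u.arg / 2 := by
    simp [Complex.mul_im, Complex.log_im]; ring
  rw [him]
  exact mul_pos (Real.exp_pos _) (Real.cos_pos_of_mem_Ioo ⟨by linarith, by linarith⟩)

theorem cpow_half_sq (u : ℂ) : (u ^ (1 / 2 : ℂ)) ^ 2 = u := by
  rw [one_div]
  exact_mod_cast Complex.cpow_nat_inv_pow u two_ne_zero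

theorem hasDerivAt_cpow_half_one_sub {w : ℂ} (hw : 1 - w ∈ Complex.slitPlane) :
    HasDerivAt (fun w : ℂ => (1 - w) ^ (1 / 2 : ℂ)) (-1 / (2 * (1 - w) ^ (1 / 2 : ℂ))) w := by
  have h := ((hasDerivAt_id w).const_sub 1).cpow_const (c := 1 / 2) hw
  refine h.congr_deriv ?_
  have h0 := Complex.slitPlane_ne_zero hw
  have hs : (1 - w) ^ (1 / 2 : ℂ) ≠ 0 := by simp [Complex.cpow_eq_zero_iff, h0]
  simp only [id]
  rw [Complex.cpow_sub _ _ h0, Complex.cpow_one]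
  have hsq := cpow_half_sq (1 - w)
  field_simp
  linear_combination -hsq

/-- The first derivative of `(1 + √(1 - w))^(1 - c) * (c - 1 + √(1 - w))`. -/
theorem hasDerivAt_hypergeometric_closed_form (c : ℂ) {w : ℂ} (hw : 1 - w ∈ Complex.slitPlane) :
    HasDerivAt (fun w : ℂ => (1 + (1 - w) ^ (1 / 2 : ℂ)) ^ (1 - c) * (c - 1 + (1 - w) ^ (1 / 2 : ℂ)))
      ((c - 2) / 2 * ((1 + (1 - w) ^ (1 / 2 : ℂ)) ^ (-c) * (1 + c / (1 - w) ^ (1 / 2 : ℂ)))) w := by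
  have hs := hasDerivAt_cpow_half_one_sub hw
  have hre := cpow_half_re_pos hw
  have hsl : 1 + (1 - w) ^ (1 / 2 : ℂ) ∈ Complex.slitPlane := by
    left; simp only [Complex.add_re, Complex.one_re]; linarith
  have h := ((hs.const_add 1).cpow_const (c := 1 - c) hsl).mul (hs.const_add (c - 1))
  refine h.congr_deriv ?_
  have h0 : (1 - w) ^ (1 / 2 : ℂ) ≠ 0 := fun h => by rw [h] at hre; exact lt_irrefl _ hre
  have h1 := Complex.slitPlane_ne_zero hsl
  have e1 : (1 - c - 1 : ℂ) = -c := by ring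
  have e2 : (1 - c : ℂ) = -c + 1 := by ring
  rw [e1, e2, Complex.cpow_add _ _ h1, Complex.cpow_one]
  generalize (1 - w) ^ (1 / 2 : ℂ) = s at *
  field_simp
  ring

/-- The second derivative of `(1 + √(1 - w))^(1 - c) * (c - 1 + √(1 - w))`. -/
theorem hasDerivAt_deriv_hypergeometric_closed_form (c : ℂ) {w : ℂ}
    (hw : 1 - w ∈ Complex.slitPlane) :
    HasDerivAt (fun w : ℂ =>
        (c - 2) / 2 * ((1 + (1 - w) ^ (1 / 2 : ℂ)) ^ (-c) * (1 + c / (1 - w) ^ (1 / 2 : ℂ))))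
      ((c - 2) * c / 4 * (1 + (1 - w) ^ (1 / 2 : ℂ)) ^ (-c - 1) *
        (((1 - w) ^ (1 / 2 : ℂ)) ^ 2 + (c + 1) * (1 - w) ^ (1 / 2 : ℂ) + 1) /
          ((1 - w) ^ (1 / 2 : ℂ)) ^ 3) w := by
  have hs := hasDerivAt_cpow_half_one_sub hw
  have hre := cpow_half_re_pos hw
  have hsl : 1 + (1 - w) ^ (1 / 2 : ℂ) ∈ Complex.slitPlane := by
    left; simp only [Complex.add_re, Complex.one_re]; linarith
  have h0 : (1 - w) ^ (1 / 2 : ℂ) ≠ 0 := fun h => by rw [h] at hre; exact lt_irrefl _ hre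
  have h := (((hs.const_add 1).cpow_const (c := -c) hsl).mul
    (((hasDerivAt_const w c).div hs h0).const_add 1)).const_mul ((c - 2) / 2)
  refine h.congr_deriv ?_
  have h1 := Complex.slitPlane_ne_zero hsl
  have e : (1 + (1 - w) ^ (1 / 2 : ℂ)) ^ (-c)
      = (1 + (1 - w) ^ (1 / 2 : ℂ)) ^ (-c - 1) * (1 + (1 - w) ^ (1 / 2 : ℂ)) := by
    rw [Complex.cpow_sub _ _ h1, Complex.cpow_one]
    field_simp
  rw [Pi.div_apply, e]
  generalize (1 - w) ^ (1 / 2 : ℂ) = s at *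
  field_simp
  ring

/-- For `c` not zero or a negative integer and `|z| < 1`,
`∑_{n=0}^∞ ((c+1)/2)_n·((c−2)/2)_n / ((c)_n·n!) · z^n
  = (2^(c−1)/c)·(1 + √(1−z))^(1−c)·(c − 1 + √(1−z))`,
where `(a)_n` is the rising factorial (Pochhammer symbol). -/
theorem stmt_11 (c : ℝ) (hc : ∀ n : ℕ, c ≠ -(n : ℝ)) (z : ℝ) (hz : |z| < 1) :
    HasSum (fun n : ℕ =>
      (ascPochhammer ℝ n).eval ((c + 1) / 2) * (ascPochhammer ℝ n).eval ((c - 2) / 2) /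
        ((ascPochhammer ℝ n).eval c * (Nat.factorial n : ℝ)) * z ^ n)
      ((2 : ℝ) ^ (c - 1) / c * (1 + Real.sqrt (1 - z)) ^ (1 - c) *
        (c - 1 + Real.sqrt (1 - z))) := by
  set g : ℂ → ℂ := fun w =>
    (1 + (1 - w) ^ (1 / 2 : ℂ)) ^ (1 - (c : ℂ)) * (c - 1 + (1 - w) ^ (1 / 2 : ℂ)) with hg
  have hd1 : ∀ w ∈ Metric.ball (0 : ℂ) 1, HasDerivAt g _ w := fun w hw =>
    hasDerivAt_hypergeometric_closed_form c (one_sub_mem_slitPlane hw)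
  have hsum : HasSum _ (g z) := hasSum_hypergeometric_of_ode (a := (c + 1) / 2) (b := (c - 2) / 2)
    hc (fun w hw => (hd1 w hw).differentiableAt.differentiableWithinAt) (fun w hw => by
      have hsl := one_sub_mem_slitPlane hw
      have hre := cpow_half_re_pos hsl
      have h0 : (1 - w) ^ (1 / 2 : ℂ) ≠ 0 := fun h => by rw [h] at hre; exact lt_irrefl _ hre
      have h1 : 1 + (1 - w) ^ (1 / 2 : ℂ) ≠ 0 := fun h => by
        have := congrArg Complex.re h
        simp only [Complex.add_re, Complex.one_re, Complex.zero_re] at this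
        linarith
      have hd2 := (hasDerivAt_deriv_hypergeometric_closed_form c hsl).congr_of_eventuallyEq
        (Filter.eventually_of_mem (Metric.isOpen_ball.mem_nhds hw) fun v hv => (hd1 v hv).deriv)
      rw [hd2.deriv, (hd1 w hw).deriv, hg]
      have e1 : (-c : ℂ) = -c - 1 + 1 := by ring
      have e2 : (1 - c : ℂ) = -c - 1 + 2 := by ring
      have hsq := cpow_half_sq (1 - w)
      have p1 : (1 + (1 - w) ^ (1 / 2 : ℂ)) ^ (-c : ℂ)
          = (1 + (1 - w) ^ (1 / 2 : ℂ)) ^ (-c - 1 : ℂ) * (1 + (1 - w) ^ (1 / 2 : ℂ)) := by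
        conv_lhs => rw [e1, Complex.cpow_add _ _ h1, Complex.cpow_one]
      have p2 : (1 + (1 - w) ^ (1 / 2 : ℂ)) ^ (1 - c : ℂ)
          = (1 + (1 - w) ^ (1 / 2 : ℂ)) ^ (-c - 1 : ℂ) * (1 + (1 - w) ^ (1 / 2 : ℂ)) ^ 2 := by
        rw [e2, Complex.cpow_add _ _ h1, Complex.cpow_ofNat]
      simp only [p1, p2]
      generalize (1 + (1 - w) ^ (1 / 2 : ℂ)) ^ (-c - 1 : ℂ) = P
      generalize (1 - w) ^ (1 / 2 : ℂ) = s at *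
      obtain rfl : w = 1 - s ^ 2 := by rw [hsq]; ring
      push_cast
      field_simp
      ring) (z := (z : ℂ)) (by simpa using hz)
  have hz1 : 0 ≤ 1 - z := by linarith [le_abs_self z]
  have hgz : g z = (((1 + Real.sqrt (1 - z)) ^ (1 - c) * (c - 1 + Real.sqrt (1 - z)) : ℝ) : ℂ) := by
    have hs : (1 - (z : ℂ)) ^ (1 / 2 : ℂ) = (Real.sqrt (1 - z) : ℂ) := by
      rw [Real.sqrt_eq_rpow, Complex.ofReal_cpow hz1]
      push_cast
      rfl
    simp only [hg, hs]
    push_cast [Complex.ofReal_cpow (show 0 ≤ 1 + Real.sqrt (1 - z) by positivity)]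
    rfl
  have hg0 : g 0 = (((2 : ℝ) ^ (1 - c) * c : ℝ) : ℂ) := by
    simp only [hg]
    push_cast [Complex.ofReal_cpow (show (0 : ℝ) ≤ 2 by norm_num)]
    norm_num
  have hc0 : c ≠ 0 := by simpa using hc 0
  rw [hgz, hg0] at hsum
  have hreal := (Complex.hasSum_ofReal.1 (by exact_mod_cast hsum)).mul_left ((2 : ℝ) ^ (c - 1) / c)
  have hpow : (2 : ℝ) ^ (c - 1) * (2 : ℝ) ^ (1 - c) = 1 := by
    rw [← Real.rpow_add two_pos]; simp
  rw [mul_assoc]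
  refine hreal.congr_fun fun n => ?_
  generalize (2 : ℝ) ^ (c - 1) = p at *
  generalize (2 : ℝ) ^ (1 - c) = q at *
  rw [show ∀ x : ℝ, p / c * (x * (q * c)) = x * (p * q) * (c / c) by intro x; ring,
    hpow, div_self hc0]
  ring
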